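/- arXiv:2602.17630 — 3 statements merged into one kernel-verified Lean document; each statement's English description precedes it below -/
import Mathlib

section
/- Lipschitz continuity of the strength in dimension 2 with constant 2√3: for any ε > 0 and any points p₀, p₁, p₂, q₀, q₁, q₂ ∈ ℝ² with |pᵢ − qᵢ| ≤ ε for each i ∈ {0,1,2}, the triangles T on p₀, p₁, p₂ and Q on q₀, q₁, q₂ satisfy |σ(T) − σ(Q)| ≤ 2√3·ε and |s(T) − s(Q)| ≤ 2√3·ε. -/
open scoped BigOperators

/-- `n×n` matrix whose columns are `p₁ - p₀, …, pₙ - p₀`. -/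
noncomputable def simMat {n : ℕ} (p : Fin (n + 1) → EuclideanSpace ℝ (Fin n)) :
    Matrix (Fin n) (Fin n) ℝ :=
  Matrix.of fun i j => (p j.succ - p 0) i

/-- Half-perimeter: half the sum of all pairwise distances. -/
noncomputable def hperim {n : ℕ} (p : Fin (n + 1) → EuclideanSpace ℝ (Fin n)) : ℝ :=
  (1 / 2) * ∑ ij ∈ Finset.univ.filter
      (fun ij : Fin (n + 1) × Fin (n + 1) => ij.1 < ij.2), dist (p ij.1) (p ij.2)

/-- Volume of the simplex on `p₀,…,pₙ`. -/
noncomputable def svol {n : ℕ} (p : Fin (n + 1) → EuclideanSpace ℝ (Fin n)) : ℝ :=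
  |(simMat p).det| / (Nat.factorial n : ℝ)

/-- Strength `σ(T) = vol(T)² / p(T)^{2n-1}` (equal to `0` when `p(T) = 0`). -/
noncomputable def strength {n : ℕ} (p : Fin (n + 1) → EuclideanSpace ℝ (Fin n)) : ℝ :=
  (svol p) ^ 2 / (hperim p) ^ (2 * n - 1)

/-- Orientation sign of the simplex, in `{-1, 0, 1}`. -/
noncomputable def ssign {n : ℕ} (p : Fin (n + 1) → EuclideanSpace ℝ (Fin n)) : ℝ :=
  Real.sign (simMat p).det

/-- Signed strength `s(T) = sign(T)·σ(T)`. -/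
noncomputable def signedStrength {n : ℕ} (p : Fin (n + 1) → EuclideanSpace ℝ (Fin n)) : ℝ :=
  ssign p * strength p


/-- Strength in terms of the tangent lengths `x = p - a` etc. -/
noncomputable def tanStr (x y z : ℝ) : ℝ := x * y * z / (x + y + z) ^ 2

lemma tanStr_lip (x x' y z : ℝ) (hx : 0 ≤ x) (hx' : 0 ≤ x') (hy : 0 ≤ y) (hz : 0 ≤ z) :
    |tanStr x y z - tanStr x' y z| ≤ 1 / 4 * |x - x'| := by
  unfold tanStr
  rcases (add_nonneg hy hz).eq_or_lt with hs | hs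
  · have hy0 : y = 0 := by linarith
    subst hy0
    simp
  · have h1 : 0 < x + y + z := by linarith
    have h2 : 0 < x' + y + z := by linarith
    have e : x * y * z / (x + y + z) ^ 2 - x' * y * z / (x' + y + z) ^ 2
        = (y * z * ((y + z) ^ 2 - x * x') / ((x + y + z) ^ 2 * (x' + y + z) ^ 2)) * (x - x') := by
      field_simp
      ring
    rw [e, abs_mul]
    apply mul_le_mul_of_nonneg_right _ (abs_nonneg _)
    have hyz : 0 ≤ y * z := mul_nonneg hy hz
    have hxx : 0 ≤ x * x' := mul_nonneg hx hx'
    set P := (x + y + z) * (x' + y + z) with hP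
    have hPpos : 0 < P := mul_pos h1 h2
    have e2 : P = (y + z) ^ 2 + x * x' + (x + x') * (y + z) := by rw [hP]; ring
    have h3 : 0 ≤ (x + x') * (y + z) := by positivity
    have h4 : 4 * (y * z) ≤ P := by nlinarith [sq_nonneg (y - z)]
    have h5 : |(y + z) ^ 2 - x * x'| ≤ P := by
      rw [abs_le]; constructor <;> nlinarith [sq_nonneg (y + z)]
    rw [abs_div, abs_mul, abs_of_nonneg hyz, ← mul_pow, ← hP, abs_of_nonneg (sq_nonneg P),
      div_le_iff₀ (by positivity)]
    calc y * z * |(y + z) ^ 2 - x * x'| ≤ y * z * P := by gcongr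
      _ ≤ 1 / 4 * P ^ 2 := by nlinarith

lemma tanStr_rot (x y z : ℝ) : tanStr x y z = tanStr y z x := by
  unfold tanStr
  rw [show x * y * z = y * z * x by ring, show x + y + z = y + z + x by ring]

lemma tanStr_lip3 (x y z x' y' z' d : ℝ) (hx : 0 ≤ x) (hx' : 0 ≤ x') (hy : 0 ≤ y) (hy' : 0 ≤ y')
    (hz : 0 ≤ z) (hz' : 0 ≤ z') (h1 : |x - x'| ≤ d) (h2 : |y - y'| ≤ d) (h3 : |z - z'| ≤ d) :
    |tanStr x y z - tanStr x' y' z'| ≤ 3 / 4 * d := by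
  have a1 := tanStr_lip x x' y z hx hx' hy hz
  have a2 := tanStr_lip y y' z x' hy hy' hz hx'
  have a3 := tanStr_lip z z' x' y' hz hz' hx' hy'
  rw [← tanStr_rot x' y z, ← tanStr_rot x' y' z] at a2
  rw [tanStr_rot z x' y', tanStr_rot z' x' y'] at a3
  have t1 := abs_sub_le (tanStr x y z) (tanStr x' y z) (tanStr x' y' z')
  have t2 := abs_sub_le (tanStr x' y z) (tanStr x' y' z) (tanStr x' y' z')
  linarith

lemma det_eq (p : Fin 3 → EuclideanSpace ℝ (Fin 2)) :
    (simMat p).det = (p 1 0 - p 0 0) * (p 2 1 - p 0 1) - (p 2 0 - p 0 0) * (p 1 1 - p 0 1) := by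
  simp [simMat, Matrix.det_fin_two]

lemma hperim_eq (p : Fin 3 → EuclideanSpace ℝ (Fin 2)) :
    hperim p = (1 / 2) * (dist (p 0) (p 1) + dist (p 0) (p 2) + dist (p 1) (p 2)) := by
  unfold hperim
  congr 1
  rw [Finset.sum_filter, Fintype.sum_prod_type]
  simp [Fin.sum_univ_three]

lemma dist_sq2 (u v : EuclideanSpace ℝ (Fin 2)) :
    dist u v ^ 2 = (u 0 - v 0) ^ 2 + (u 1 - v 1) ^ 2 := by
  rw [EuclideanSpace.dist_eq, Real.sq_sqrt (by positivity), Fin.sum_univ_two]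
  simp [Real.dist_eq, sq_abs]

lemma strength_eq (p : Fin 3 → EuclideanSpace ℝ (Fin 2)) :
    strength p = tanStr
      ((dist (p 0) (p 1) + dist (p 0) (p 2) - dist (p 1) (p 2)) / 2)
      ((dist (p 0) (p 1) + dist (p 1) (p 2) - dist (p 0) (p 2)) / 2)
      ((dist (p 0) (p 2) + dist (p 1) (p 2) - dist (p 0) (p 1)) / 2) := by
  unfold strength svol tanStr
  rw [hperim_eq, det_eq]
  have ha := dist_sq2 (p 0) (p 1)
  have hb := dist_sq2 (p 0) (p 2)
  have hc := dist_sq2 (p 1) (p 2)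
  set a := dist (p 0) (p 1)
  set b := dist (p 0) (p 2)
  set c := dist (p 1) (p 2)
  have hS : (a + b - c) / 2 + (a + c - b) / 2 + (b + c - a) / 2 = 1 / 2 * (a + b + c) := by ring
  have heron : (|(p 1 0 - p 0 0) * (p 2 1 - p 0 1) - (p 2 0 - p 0 0) * (p 1 1 - p 0 1)|
      / (Nat.factorial 2 : ℝ)) ^ 2
      = (1 / 2 * (a + b + c)) * ((a + b - c) / 2 * ((a + c - b) / 2) * ((b + c - a) / 2)) := by
    have : (1 / 2 * (a + b + c)) * ((a + b - c) / 2 * ((a + c - b) / 2) * ((b + c - a) / 2))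
      = (4 * (a ^ 2 * b ^ 2) - (a ^ 2 + b ^ 2 - c ^ 2) ^ 2) / 16 := by ring
    rw [this, ha, hb, hc, div_pow, sq_abs]
    norm_num [Nat.factorial]
    ring
  rw [heron, hS]
  show _ / (1 / 2 * (a + b + c)) ^ 3 = _
  by_cases h0 : 1 / 2 * (a + b + c) = 0
  · rw [h0]; simp
  · generalize 1 / 2 * (a + b + c) = s at *
    field_simp

lemma strength_lip (ε : ℝ) (p q : Fin 3 → EuclideanSpace ℝ (Fin 2))
    (h : ∀ i, dist (p i) (q i) ≤ ε) : |strength p - strength q| ≤ 9 / 4 * ε := by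
  rw [strength_eq, strength_eq]
  have key : ∀ i j, |dist (p i) (p j) - dist (q i) (q j)| ≤ 2 * ε := fun i j => by
    have := dist_dist_dist_le (p i) (p j) (q i) (q j)
    rw [Real.dist_eq] at this
    linarith [h i, h j]
  have tri : ∀ r : Fin 3 → EuclideanSpace ℝ (Fin 2),
      0 ≤ (dist (r 0) (r 1) + dist (r 0) (r 2) - dist (r 1) (r 2)) / 2 ∧
      0 ≤ (dist (r 0) (r 1) + dist (r 1) (r 2) - dist (r 0) (r 2)) / 2 ∧
      0 ≤ (dist (r 0) (r 2) + dist (r 1) (r 2) - dist (r 0) (r 1)) / 2 := fun r => by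
    have t1 := dist_triangle_left (r 1) (r 2) (r 0)
    have t2 := dist_triangle (r 0) (r 1) (r 2)
    have t3 := dist_triangle_right (r 0) (r 1) (r 2)
    refine ⟨?_, ?_, ?_⟩ <;> linarith
  obtain ⟨p1, p2, p3⟩ := tri p
  obtain ⟨q1, q2, q3⟩ := tri q
  have k1 := abs_le.mp (key 0 1)
  have k2 := abs_le.mp (key 0 2)
  have k3 := abs_le.mp (key 1 2)
  refine (tanStr_lip3 _ _ _ _ _ _ (3 * ε) p1 q1 p2 q2 p3 q3 ?_ ?_ ?_).trans (by linarith) <;>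
  · rw [abs_le]; constructor <;> linarith

lemma strength_nonneg (p : Fin 3 → EuclideanSpace ℝ (Fin 2)) : 0 ≤ strength p := by
  unfold strength
  rw [hperim_eq]
  positivity

lemma strength_of_det (p : Fin 3 → EuclideanSpace ℝ (Fin 2)) (h : (simMat p).det = 0) :
    strength p = 0 := by
  simp [strength, svol, h]

/-- If the determinants have opposite signs, the strengths add up to at most `9/4 ε`. -/
lemma strength_cross (ε : ℝ) (p q : Fin 3 → EuclideanSpace ℝ (Fin 2))
    (h : ∀ i, dist (p i) (q i) ≤ ε) (hp : (simMat p).det ≤ 0) (hq : 0 ≤ (simMat q).det) :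
    strength p + strength q ≤ 9 / 4 * ε := by
  let r : ℝ → Fin 3 → EuclideanSpace ℝ (Fin 2) := fun t i => AffineMap.lineMap (p i) (q i) t
  have hr0 : r 0 = p := by funext i; simp [r]
  have hr1 : r 1 = q := by funext i; simp [r]
  have hcont : Continuous fun t => (simMat (r t)).det := by
    simp only [det_eq, r, AffineMap.lineMap_apply_module]
    simp only [PiLp.add_apply, PiLp.smul_apply, smul_eq_mul]
    fun_prop
  obtain ⟨t, ⟨ht0, ht1⟩, ht⟩ := intermediate_value_Icc (zero_le_one (α := ℝ)) hcont.continuousOn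
    (show (0 : ℝ) ∈ Set.Icc _ _ from ⟨by simpa only [hr0] using hp, by simpa only [hr1] using hq⟩)
  have hz := strength_of_det (r t) ht
  have l1 := strength_lip (t * ε) p (r t) (fun i => by
    simp only [r, dist_left_lineMap, Real.norm_eq_abs, abs_of_nonneg ht0]
    exact mul_le_mul_of_nonneg_left (h i) ht0)
  have l2 := strength_lip ((1 - t) * ε) (r t) q (fun i => by
    simp only [r, dist_lineMap_right, Real.norm_eq_abs, abs_of_nonneg (sub_nonneg.mpr ht1)]
    exact mul_le_mul_of_nonneg_left (h i) (sub_nonneg.mpr ht1))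
  rw [hz] at l1 l2
  have := (abs_le.mp l1).2
  have := (abs_le.mp l2).1
  linarith

lemma signed_lip (ε : ℝ) (p q : Fin 3 → EuclideanSpace ℝ (Fin 2))
    (h : ∀ i, dist (p i) (q i) ≤ ε) :
    |signedStrength p - signedStrength q| ≤ 9 / 4 * ε := by
  have hl := strength_lip ε p q h
  have np := strength_nonneg p
  have nq := strength_nonneg q
  have hsym : ∀ i, dist (q i) (p i) ≤ ε := fun i => by rw [dist_comm]; exact h i
  have hl' := abs_le.mp hl
  unfold signedStrength ssign
  rcases lt_trichotomy (simMat p).det 0 with a | a | a <;>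
  rcases lt_trichotomy (simMat q).det 0 with b | b | b
  · rw [Real.sign_of_neg a, Real.sign_of_neg b, abs_le]; constructor <;> linarith
  · have z := strength_of_det q b
    rw [Real.sign_of_neg a, z, abs_le]; constructor <;> linarith
  · have c := strength_cross ε p q h a.le b.le
    rw [Real.sign_of_neg a, Real.sign_of_pos b, abs_le]; constructor <;> linarith
  · have z := strength_of_det p a
    rw [Real.sign_of_neg b, z, abs_le]; constructor <;> linarith
  · have z := strength_of_det p a
    have z' := strength_of_det q b
    rw [z, z', abs_le]; constructor <;> linarith
  · have z := strength_of_det p a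
    rw [Real.sign_of_pos b, z, abs_le]; constructor <;> linarith
  · have c := strength_cross ε q p hsym b.le a.le
    rw [Real.sign_of_pos a, Real.sign_of_neg b, abs_le]; constructor <;> linarith
  · have z := strength_of_det q b
    rw [Real.sign_of_pos a, z, abs_le]; constructor <;> linarith
  · rw [Real.sign_of_pos a, Real.sign_of_pos b, abs_le]; constructor <;> linarith

/-- Lipschitz continuity of the strength and signed strength in dimension 2
with constant `2·λ₂ = 2√3`. -/
theorem strength_lipschitz_dim2 (ε : ℝ) (hε : 0 < ε)
    (p q : Fin 3 → EuclideanSpace ℝ (Fin 2))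
    (h : ∀ i, dist (p i) (q i) ≤ ε) :
    |strength p - strength q| ≤ 2 * Real.sqrt 3 * ε ∧
      |signedStrength p - signedStrength q| ≤ 2 * Real.sqrt 3 * ε := by
  have h3 : (9 / 8 : ℝ) ≤ Real.sqrt 3 := Real.le_sqrt_of_sq_le (by norm_num)
  have hc : 9 / 4 * ε ≤ 2 * Real.sqrt 3 * ε :=
    mul_le_mul_of_nonneg_right (by linarith) hε.le
  exact ⟨(strength_lip ε p q h).trans hc, (signed_lip ε p q h).trans hc⟩
end

section
/- Lipschitz continuity of the strength in dimension n ≥ 3: for any integer n ≥ 3, any ε > 0, and any points p₀,…,pₙ, q₀,…,qₙ ∈ ℝⁿ with |pᵢ − qᵢ| ≤ ε for each i = 0,…,n, the simplices T on p₀,…,pₙ and Q on q₀,…,qₙ satisfy |σ(T) − σ(Q)| ≤ 2·λₙ·ε and |s(T) − s(Q)| ≤ 2·λₙ·ε, where λₙ = 2^{n + 1/2}/(n!·n^{2n−4}). -/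
open scoped BigOperators

lemma four_hperim {n : ℕ} (p : Fin (n + 1) → EuclideanSpace ℝ (Fin n)) :
    4 * hperim p = ∑ i, ∑ j, dist (p i) (p j) := by
  have key : ∀ i j, dist (p i) (p j) =
      (if i < j then dist (p i) (p j) else 0) + (if j < i then dist (p j) (p i) else 0) := by
    intro i j
    rcases lt_trichotomy i j with h | h | h
    · simp [h, h.not_gt]
    · simp [h]
    · simp [h, h.not_gt, dist_comm]
  have e : ∑ i, ∑ j, dist (p i) (p j) =
      ∑ i, ∑ j, (if i < j then dist (p i) (p j) else 0) +
      ∑ i, ∑ j, (if j < i then dist (p j) (p i) else 0) := by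
    rw [← Finset.sum_add_distrib]
    refine Finset.sum_congr rfl fun i _ => ?_
    rw [← Finset.sum_add_distrib]
    exact Finset.sum_congr rfl fun j _ => key i j
  have e2 : ∑ i, ∑ j, (if j < i then dist (p j) (p i) else 0) =
      ∑ i, ∑ j, (if i < j then dist (p i) (p j) else 0) := Finset.sum_comm
  have e3 : ∑ ij ∈ Finset.univ.filter
      (fun ij : Fin (n + 1) × Fin (n + 1) => ij.1 < ij.2), dist (p ij.1) (p ij.2) =
      ∑ i, ∑ j, (if i < j then dist (p i) (p j) else 0) := by
    rw [Finset.sum_filter, Fintype.sum_prod_type]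
  rw [e, e2, hperim, e3]; ring

lemma hperim_nonneg' {n : ℕ} (p : Fin (n + 1) → EuclideanSpace ℝ (Fin n)) : 0 ≤ hperim p := by
  unfold hperim; positivity

lemma dist_le_hperim {n : ℕ} (p : Fin (n + 1) → EuclideanSpace ℝ (Fin n))
    (i j : Fin (n + 1)) : (n : ℝ) * dist (p i) (p j) ≤ 2 * hperim p := by
  have h4 := four_hperim p
  by_cases hij : i = j
  · subst hij; simpa using hperim_nonneg' p
  set d := dist (p i) (p j) with hd
  set r : Fin (n + 1) → ℝ := fun k => ∑ l, dist (p k) (p l) with hr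
  have hrk : ∀ k, d ≤ r k := by
    intro k
    have h1 : ∑ l ∈ ({i, j} : Finset (Fin (n + 1))), dist (p k) (p l) ≤ r k :=
      Finset.sum_le_sum_of_subset_of_nonneg (Finset.subset_univ _) (fun _ _ _ => dist_nonneg)
    rw [Finset.sum_pair hij] at h1
    have := dist_triangle_left (p i) (p j) (p k)
    linarith
  have hsum : ((n : ℝ) + 1) * d ≤ r i + r j := by
    have : ∑ _l : Fin (n + 1), d ≤ ∑ l, (dist (p i) (p l) + dist (p j) (p l)) :=
      Finset.sum_le_sum fun l _ => dist_triangle_right _ _ _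
    rw [Finset.sum_add_distrib] at this
    simpa using this
  have htot : ∑ k, (r k - d) ≥ ∑ k ∈ ({i, j} : Finset (Fin (n + 1))), (r k - d) :=
      Finset.sum_le_sum_of_subset_of_nonneg (Finset.subset_univ _)
        (fun k _ _ => sub_nonneg.2 (hrk k))
  rw [Finset.sum_pair hij, Finset.sum_sub_distrib, ← h4] at htot
  simp at htot
  linarith

lemma hperim_sub_le {n : ℕ} (p q : Fin (n + 1) → EuclideanSpace ℝ (Fin n)) (ε : ℝ)
    (h : ∀ i, dist (p i) (q i) ≤ ε) :
    hperim p - hperim q ≤ ((n : ℝ) + 1) ^ 2 / 2 * ε := by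
  have h1 := four_hperim p
  have h2 := four_hperim q
  have h3 : ∑ i, ∑ j, dist (p i) (p j) ≤ ∑ i, ∑ j, (dist (q i) (q j) + 2 * ε) := by
    refine Finset.sum_le_sum fun i _ => Finset.sum_le_sum fun j _ => ?_
    have := dist_triangle4 (p i) (q i) (q j) (p j)
    have a := h i
    have b := h j
    rw [dist_comm] at b
    linarith
  simp only [Finset.sum_add_distrib] at h3
  simp at h3
  nlinarith

lemma exists_form (n : ℕ) : ∃ f : MultilinearMap ℝ
    (fun _ : Fin n => EuclideanSpace ℝ (Fin n)) ℝ,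
    (∀ v, ‖f v‖ ≤ 1 * ∏ i, ‖v i‖) ∧
    ∀ p : Fin (n + 1) → EuclideanSpace ℝ (Fin n),
      (simMat p).det = f (fun j => p j.succ - p 0) := by
  have : Fact (Module.finrank ℝ (EuclideanSpace ℝ (Fin n)) = n) := ⟨by simp⟩
  let b := EuclideanSpace.basisFun (Fin n) ℝ
  refine ⟨(b.toBasis.det).toMultilinearMap, ?_, ?_⟩
  · intro v
    have := (b.toBasis.orientation).abs_volumeForm_apply_le v
    rw [(b.toBasis.orientation).volumeForm_robust b rfl] at this
    simpa using this
  · intro p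
    change _ = b.toBasis.det _
    rw [Module.Basis.det_apply]
    congr 1

lemma det_le {n : ℕ} (hn : 3 ≤ n) (p : Fin (n + 1) → EuclideanSpace ℝ (Fin n)) :
    |(simMat p).det| ≤ (2 / n * hperim p) ^ n := by
  obtain ⟨f, hf, hp⟩ := exists_form n
  have hn0 : (0 : ℝ) < n := by positivity
  rw [hp p]
  refine (hf _).trans ?_
  rw [one_mul]
  calc ∏ i : Fin n, ‖p i.succ - p 0‖ ≤ ∏ _i : Fin n, (2 / n * hperim p) := by
        refine Finset.prod_le_prod (fun _ _ => norm_nonneg _) fun i _ => ?_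
        have := dist_le_hperim p i.succ 0
        rw [← dist_eq_norm, div_mul_eq_mul_div, le_div_iff₀ hn0]
        linarith
    _ = _ := by simp

lemma det_sub_le {n : ℕ} (hn : 3 ≤ n) (p q : Fin (n + 1) → EuclideanSpace ℝ (Fin n)) (ε : ℝ)
    (hε : 0 < ε) (h : ∀ i, dist (p i) (q i) ≤ ε) (hpq : hperim q ≤ hperim p) :
    |(simMat p).det - (simMat q).det| ≤ n * (2 / n * hperim p) ^ (n - 1) * (2 * ε) := by
  obtain ⟨f, hf, hp⟩ := exists_form n
  have hn0 : (0 : ℝ) < n := by positivity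
  have hP := hperim_nonneg' p
  have hb : ∀ r : Fin (n + 1) → EuclideanSpace ℝ (Fin n), hperim r ≤ hperim p →
      ‖(fun j : Fin n => r j.succ - r 0)‖ ≤ 2 / n * hperim p := by
    intro r hr
    refine (pi_norm_le_iff_of_nonneg (by positivity)).2 fun i => ?_
    have := dist_le_hperim r i.succ 0
    rw [← dist_eq_norm, div_mul_eq_mul_div, le_div_iff₀ hn0]
    linarith
  rw [hp p, hp q]
  refine (f.norm_image_sub_le_of_bound zero_le_one hf _ _).trans ?_
  rw [one_mul, Fintype.card_fin]
  have h1 := hb p le_rfl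
  have h2 := hb q hpq
  have h3 : ‖(fun j : Fin n => p j.succ - p 0) - (fun j : Fin n => q j.succ - q 0)‖ ≤ 2 * ε := by
    refine (pi_norm_le_iff_of_nonneg (by positivity)).2 fun i => ?_
    have a := h i.succ
    have b := h 0
    rw [dist_eq_norm] at a b
    have e : ((fun j : Fin n => p j.succ - p 0) - (fun j : Fin n => q j.succ - q 0)) i =
      (p i.succ - q i.succ) - (p 0 - q 0) := by simp only [Pi.sub_apply]; abel
    rw [e]
    have := norm_sub_le (p i.succ - q i.succ) (p 0 - q 0)
    linarith
  gcongr
  exact max_le h1 h2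

lemma abs_mul_abs_sub (a b : ℝ) : |(a * |a|) - (b * |b|)| ≤ |a - b| * (|a| + |b|) := by
  rcases le_total 0 a with ha | ha <;> rcases le_total 0 b with hb | hb
  · rw [abs_of_nonneg ha, abs_of_nonneg hb, ← abs_of_nonneg (add_nonneg ha hb), ← abs_mul]
    apply le_of_eq; congr 1; ring
  · rw [abs_of_nonneg ha, abs_of_nonpos hb, abs_le]
    rw [abs_of_nonneg (by linarith : 0 ≤ a - b)]
    constructor <;> nlinarith [mul_nonneg ha (neg_nonneg.2 hb), sq_nonneg a, sq_nonneg b]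
  · rw [abs_of_nonpos ha, abs_of_nonneg hb, abs_le]
    rw [abs_of_nonpos (by linarith : a - b ≤ 0)]
    constructor <;> nlinarith [mul_nonneg hb (neg_nonneg.2 ha), sq_nonneg a, sq_nonneg b]
  · rw [abs_of_nonpos ha, abs_of_nonpos hb, ← abs_of_nonneg (by linarith : 0 ≤ -a + -b), ← abs_mul]
    apply le_of_eq; congr 1; ring

lemma signed_eq {n : ℕ} (p : Fin (n + 1) → EuclideanSpace ℝ (Fin n)) :
    signedStrength p = (simMat p).det * |(simMat p).det| / hperim p ^ (2 * n - 1)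
      / (n.factorial : ℝ) ^ 2 := by
  unfold signedStrength ssign strength svol
  have : Real.sign (simMat p).det * |(simMat p).det| = (simMat p).det := by
    rcases lt_trichotomy (simMat p).det 0 with h | h | h
    · rw [Real.sign_of_neg h, abs_of_neg h]; ring
    · simp [h]
    · rw [Real.sign_of_pos h, abs_of_pos h]; ring
  calc _ = (Real.sign (simMat p).det * |(simMat p).det|) * |(simMat p).det| /
        hperim p ^ (2 * n - 1) / (n.factorial : ℝ) ^ 2 := by ring
    _ = _ := by rw [this]

lemma strength_eq_s6 {n : ℕ} (p : Fin (n + 1) → EuclideanSpace ℝ (Fin n)) :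
    strength p = |signedStrength p| := by
  rw [signed_eq, abs_div, abs_div, abs_mul, abs_abs, strength, svol,
    abs_of_nonneg (pow_nonneg (hperim_nonneg' p) _),
    abs_of_nonneg (sq_nonneg (n.factorial : ℝ))]
  ring

/-- one-variable estimate -/
lemma pow_sub_bound (k : ℕ) (P R : ℝ) (hR : 0 ≤ R) (hRP : R ≤ P) :
    P ^ (k + 1) - R ^ (k + 1) ≤ (k + 1) * P ^ k * (P - R) := by
  have hP := hR.trans hRP
  induction k with
  | zero => simp
  | succ k ih =>
    have h1 : R ^ (k + 1) ≤ P ^ (k + 1) := by gcongr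
    have h2 := mul_le_mul_of_nonneg_left ih hP
    have h3 := mul_le_mul_of_nonneg_right h1 (sub_nonneg.2 hRP)
    push_cast
    have e : P ^ (k + 1 + 1) - R ^ (k + 1 + 1) =
      P * (P ^ (k + 1) - R ^ (k + 1)) + R ^ (k + 1) * (P - R) := by ring
    rw [e]
    have e2 : ((k : ℝ) + 1 + 1) * P ^ (k + 1) * (P - R) =
      P * ((k + 1) * P ^ k * (P - R)) + P ^ (k + 1) * (P - R) := by ring
    rw [e2]; linarith

/-- abstract real estimate, exponent `m + 1 = n` -/
lemma real_bound (m : ℕ) (a b P R c K : ℝ) (hR : 0 ≤ R) (hRP : R ≤ P) (hc : 0 ≤ c) (hK : 0 ≤ K)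
    (ha : |a| ≤ c ^ (m + 1) * P ^ (m + 1)) (hb : |b| ≤ c ^ (m + 1) * R ^ (m + 1))
    (hab : |a - b| ≤ K * P ^ m) :
    |a * |a| / P ^ (2 * m + 1) - b * |b| / R ^ (2 * m + 1)| ≤
      2 * K * c ^ (m + 1) + (2 * m + 1) * (c ^ (m + 1)) ^ 2 * (P - R) := by
  have hP := hR.trans hRP
  have hcm : 0 ≤ c ^ (m + 1) := by positivity
  generalize c ^ (m + 1) = C at *
  rcases hP.eq_or_lt with h0 | hP0
  · have : R = 0 := by linarith
    subst this
    subst h0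
    simp
    positivity
  have hb' : |b| ≤ C * P ^ (m + 1) := hb.trans (by gcongr)
  have first : |a * |a| / P ^ (2 * m + 1) - b * |b| / P ^ (2 * m + 1)| ≤ 2 * K * C := by
    rw [← sub_div, abs_div, abs_of_pos (pow_pos hP0 (2 * m + 1)), div_le_iff₀ (by positivity)]
    calc _ ≤ |a - b| * (|a| + |b|) := abs_mul_abs_sub a b
      _ ≤ (K * P ^ m) * (C * P ^ (m + 1) + C * P ^ (m + 1)) := by gcongr
      _ = _ := by ring
  have second : |b * |b| / P ^ (2 * m + 1) - b * |b| / R ^ (2 * m + 1)| ≤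
      (2 * m + 1) * C ^ 2 * (P - R) := by
    rcases hR.eq_or_lt with h0 | hR0
    · subst h0
      have : b = 0 := by simpa using hb
      subst this
      simp
      positivity
    have h1 := pow_sub_bound (2 * m) P R hR hRP
    have hle : R ^ (2 * m + 1) ≤ P ^ (2 * m + 1) := by gcongr
    have e : b * |b| / P ^ (2 * m + 1) - b * |b| / R ^ (2 * m + 1) =
      - (b * |b| * (P ^ (2 * m + 1) - R ^ (2 * m + 1)) / (P ^ (2 * m + 1) * R ^ (2 * m + 1))) := by
      field_simp; ring
    rw [e, abs_neg, abs_div, abs_mul, abs_mul, abs_abs, abs_of_nonneg (sub_nonneg.2 hle),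
      abs_of_pos (by positivity : 0 < P ^ (2 * m + 1) * R ^ (2 * m + 1)),
      div_le_iff₀ (by positivity)]
    push_cast at h1
    have hd : 0 ≤ P - R := sub_nonneg.2 hRP
    calc |b| * |b| * (P ^ (2 * m + 1) - R ^ (2 * m + 1))
        ≤ (C * R ^ (m + 1)) * (C * R ^ (m + 1)) * ((2 * m + 1) * P ^ (2 * m) * (P - R)) := by
          have : 0 ≤ P ^ (2 * m + 1) - R ^ (2 * m + 1) := sub_nonneg.2 hle
          gcongr
      _ = ((2 * m + 1) * C ^ 2 * (P - R) * P ^ (2 * m) * R ^ (2 * m + 1)) * R := by ring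
      _ ≤ ((2 * m + 1) * C ^ 2 * (P - R) * P ^ (2 * m) * R ^ (2 * m + 1)) * P := by gcongr
      _ = _ := by ring
  have := abs_sub_le (a * |a| / P ^ (2 * m + 1)) (b * |b| / P ^ (2 * m + 1))
    (b * |b| / R ^ (2 * m + 1))
  linarith

lemma two_pow_le (n : ℕ) (hn : 1 ≤ n) : 2 ^ n ≤ 2 * n.factorial := by
  induction n, hn using Nat.le_induction with
  | base => simp
  | succ k hk ih =>
    rw [pow_succ, Nat.factorial_succ]
    nlinarith

lemma const_bound (n : ℕ) (hn : 3 ≤ n) (ε : ℝ) (hε : 0 < ε) :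
    (2 * (n * (2 / n : ℝ) ^ (n - 1) * (2 * ε)) * (2 / n : ℝ) ^ n +
      (2 * n - 1) * ((2 / n : ℝ) ^ n) ^ 2 * (((n : ℝ) + 1) ^ 2 / 2 * ε)) / (n.factorial : ℝ) ^ 2 ≤
    2 * (Real.sqrt 2 * 2 ^ n / ((Nat.factorial n : ℝ) * (n : ℝ) ^ (2 * n - 4))) * ε := by
  have hs : 1 ≤ Real.sqrt 2 := by rw [Real.one_le_sqrt]; norm_num
  have hf : (0 : ℝ) < n.factorial := by exact_mod_cast n.factorial_pos
  have h2 : (2 : ℝ) ^ n ≤ 2 * n.factorial := by exact_mod_cast two_pow_le n (by omega)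
  obtain ⟨k, rfl⟩ : ∃ k, n = k + 2 := ⟨n - 2, by omega⟩
  have e1 : k + 2 - 1 = k + 1 := rfl
  have e2 : 2 * (k + 2) - 4 = 2 * k := by omega
  rw [e1, e2]
  have hN : (3 : ℝ) ≤ ((k + 2 : ℕ) : ℝ) := by exact_mod_cast hn
  generalize ((k + 2 : ℕ) : ℝ) = N at *
  generalize ((k + 2).factorial : ℝ) = F at *
  have hN0 : 0 < N := by linarith
  have hT : (0 : ℝ) < 2 ^ k := by positivity
  have lhs : (2 * (N * (2 / N) ^ (k + 1) * (2 * ε)) * (2 / N) ^ (k + 2) +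
      (2 * N - 1) * ((2 / N) ^ (k + 2)) ^ 2 * ((N + 1) ^ 2 / 2 * ε)) / F ^ 2 =
      (32 * N ^ 2 + 8 * (2 * N - 1) * (N + 1) ^ 2) * (2 ^ k) ^ 2 * ε / (N ^ (2 * k) * N ^ 4 * F ^ 2) := by
    simp only [div_pow]
    field_simp
    ring
  rw [lhs]
  have rhs : 2 * (Real.sqrt 2 * 2 ^ (k + 2) / (F * N ^ (2 * k))) * ε =
      (8 * Real.sqrt 2 * 2 ^ k * N ^ 4 * F) * ε / (N ^ (2 * k) * N ^ 4 * F ^ 2) := by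
    field_simp
    ring
  rw [rhs]
  refine div_le_div_of_nonneg_right (mul_le_mul_of_nonneg_right ?_ hε.le) (by positivity)
  have h3 : 2 * (2 : ℝ) ^ k ≤ F := by rw [pow_add] at h2; linarith
  have poly : (32 * N ^ 2 + 8 * (2 * N - 1) * (N + 1) ^ 2) ≤ 16 * N ^ 4 := by
    obtain ⟨x, rfl⟩ : ∃ x, N = x + 3 := ⟨N - 3, by ring⟩
    have hx : 0 ≤ x := by linarith
    have : 0 ≤ 16 * (x + 3) ^ 4 - (32 * (x + 3) ^ 2 + 8 * (2 * (x + 3) - 1) * (x + 3 + 1) ^ 2) := by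
      ring_nf; positivity
    linarith
  calc _ ≤ 16 * N ^ 4 * (2 ^ k) ^ 2 := by gcongr
    _ = 8 * 1 * 2 ^ k * N ^ 4 * (2 * 2 ^ k) := by ring
    _ ≤ 8 * Real.sqrt 2 * 2 ^ k * N ^ 4 * F := by gcongr

lemma signed_bound (n : ℕ) (hn : 3 ≤ n) (ε : ℝ) (hε : 0 < ε)
    (p q : Fin (n + 1) → EuclideanSpace ℝ (Fin n))
    (h : ∀ i, dist (p i) (q i) ≤ ε) (hpq : hperim q ≤ hperim p) :
      |signedStrength p - signedStrength q| ≤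
        2 * (Real.sqrt 2 * 2 ^ n / ((Nat.factorial n : ℝ) * (n : ℝ) ^ (2 * n - 4))) * ε := by
  refine le_trans ?_ (const_bound n hn ε hε)
  rw [signed_eq, signed_eq, ← sub_div, abs_div, abs_of_nonneg (sq_nonneg (n.factorial : ℝ))]
  have ha := det_le hn p
  have hb := det_le hn q
  have hab := det_sub_le hn p q ε hε h hpq
  have hd := hperim_sub_le p q ε h
  have hq := hperim_nonneg' q
  have hn1 : (3 : ℝ) ≤ n := by exact_mod_cast hn
  gcongr
  generalize (simMat p).det = a at *
  generalize (simMat q).det = b at *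
  generalize hperim p = P at *
  generalize hperim q = R at *
  clear h
  obtain ⟨m, rfl⟩ : ∃ m, n = m + 1 := ⟨n - 1, by omega⟩
  have e1 : 2 * (m + 1) - 1 = 2 * m + 1 := by omega
  rw [e1]
  simp only [Nat.add_sub_cancel] at *
  rw [mul_pow] at ha hb hab
  have := real_bound m a b P R (2 / (m + 1 : ℕ))
    ((m + 1 : ℕ) * (2 / (m + 1 : ℕ)) ^ m * (2 * ε)) hq hpq (by positivity) (by positivity)
    ha hb (hab.trans (le_of_eq (by ring)))
  refine this.trans ?_
  have e3 : (2 * ((m + 1 : ℕ) : ℝ) - 1) = 2 * m + 1 := by push_cast; ring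
  rw [e3]
  gcongr



/-- Lipschitz continuity of the strength and signed strength in dimension
`n ≥ 3` with Lipschitz constant `λₙ = 2^{n+1/2} / (n!·n^{2n-4})`. -/
theorem strength_lipschitz_high_dim (n : ℕ) (hn : 3 ≤ n) (ε : ℝ) (hε : 0 < ε)
    (p q : Fin (n + 1) → EuclideanSpace ℝ (Fin n))
    (h : ∀ i, dist (p i) (q i) ≤ ε) :
    |strength p - strength q| ≤
        2 * (Real.sqrt 2 * 2 ^ n / ((Nat.factorial n : ℝ) * (n : ℝ) ^ (2 * n - 4))) * ε ∧
      |signedStrength p - signedStrength q| ≤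
        2 * (Real.sqrt 2 * 2 ^ n / ((Nat.factorial n : ℝ) * (n : ℝ) ^ (2 * n - 4))) * ε := by
  have key : |signedStrength p - signedStrength q| ≤
        2 * (Real.sqrt 2 * 2 ^ n / ((Nat.factorial n : ℝ) * (n : ℝ) ^ (2 * n - 4))) * ε := by
    rcases le_total (hperim q) (hperim p) with hpq | hpq
    · exact signed_bound n hn ε hε p q h hpq
    · rw [abs_sub_comm]
      exact signed_bound n hn ε hε q p (fun i => by rw [dist_comm]; exact h i) hpq
  refine ⟨?_, key⟩
  rw [strength_eq_s6, strength_eq_s6]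
  exact (abs_abs_sub_abs_le _ _).trans key
end

section
/- Edge ratio bound: for any n ≥ 1, any points p₀,…,pₙ ∈ ℝⁿ, and any indices 0 ≤ i < j ≤ n, the distance between two vertices satisfies n·|p_i − p_j| ≤ 2·p(T), i.e. |p_i − p_j|/p(T) ≤ 2/n whenever p(T) > 0. -/
open scoped BigOperators

/-- edge ratio bound `n·|pᵢ - pⱼ| ≤ 2·p(T)`; equivalently,
`|pᵢ - pⱼ|/p(T) ≤ 2/n` whenever `p(T) > 0`. -/
theorem edge_ratio_bound (n : ℕ) (hn : 1 ≤ n)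
    (p : Fin (n + 1) → EuclideanSpace ℝ (Fin n)) (i j : Fin (n + 1)) (hij : i < j) :
    (n : ℝ) * dist (p i) (p j) ≤ 2 * hperim p ∧
      (0 < hperim p → dist (p i) (p j) / hperim p ≤ 2 / (n : ℝ)) := by
  set d := dist (p i) (p j) with hd
  have hne : i ≠ j := ne_of_lt hij
  -- the sum over all ordered pairs is twice the sum over `a < b`
  have hF : ∑ a, ∑ b, dist (p a) (p b) = 4 * hperim p := by
    have h1 : ∑ a, ∑ b, dist (p a) (p b)
        = ∑ a, ∑ b, ((if a < b then dist (p a) (p b) else 0)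
          + (if b < a then dist (p b) (p a) else 0)) := by
      refine Finset.sum_congr rfl fun a _ => Finset.sum_congr rfl fun b _ => ?_
      rcases lt_trichotomy a b with h | h | h
      · simp [h, h.not_gt]
      · simp [h]
      · simp [h, h.not_gt, dist_comm]
    have h2 : ∑ a, ∑ b, (if b < a then dist (p b) (p a) else 0)
        = ∑ a, ∑ b, (if a < b then dist (p a) (p b) else 0) := Finset.sum_comm
    have h3 : hperim p = (1 / 2) * ∑ a, ∑ b, (if a < b then dist (p a) (p b) else 0) := by
      rw [hperim, Finset.sum_filter, Fintype.sum_prod_type]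
    rw [h1, h3]
    simp only [Finset.sum_add_distrib]
    rw [h2]
    ring
  have hr : ∀ k, d ≤ ∑ b, dist (p k) (p b) := by
    intro k
    have h := Finset.sum_le_sum_of_subset_of_nonneg (Finset.subset_univ {i, j})
      (f := fun b => dist (p k) (p b)) (fun b _ _ => dist_nonneg)
    rw [Finset.sum_pair hne] at h
    exact (dist_triangle_left (p i) (p j) (p k)).trans h
  have hsum : ((n : ℝ) + 1) * d ≤ (∑ b, dist (p i) (p b)) + ∑ b, dist (p j) (p b) := by
    rw [← Finset.sum_add_distrib]
    have h : ∑ _b : Fin (n + 1), d ≤ ∑ b, (dist (p i) (p b) + dist (p j) (p b)) :=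
      Finset.sum_le_sum fun b _ => dist_triangle_right (p i) (p j) (p b)
    simpa using h
  have hmain : (n : ℝ) * d ≤ 2 * hperim p := by
    have h := Finset.sum_le_sum_of_subset_of_nonneg (Finset.subset_univ {i, j})
      (f := fun k => (∑ b, dist (p k) (p b)) - d) (fun k _ _ => sub_nonneg.2 (hr k))
    rw [Finset.sum_pair hne, Finset.sum_sub_distrib, hF] at h
    simp at h
    linarith
  refine ⟨hmain, fun hp => ?_⟩
  have hn' : (0 : ℝ) < n := by exact_mod_cast hn
  rw [div_le_div_iff₀ hp hn']
  linarith
end
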